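/- arXiv:2003.07814 — 5 statements merged into one kernel-verified Lean document; each statement's English description precedes it below -/
import Mathlib

section
/- For all m, n ∈ ℕ, the polynomial ℘_q(m,n) equals the nested sum Σ_{i=0}^{min(⌊m/3⌋, ⌊n/2⌋)} Σ_{j=0}^{min(⌊(m−3i)/3⌋, n−2i)} Σ_{k=0}^{min(⌊(m−3i−3j)/2⌋, n−2i−j)} Σ_{l=0}^{min(m−3i−3j−2k, n−2i−j−k)} q^{m+n−4i−3j−2k−l}. -/
open Polynomial Finset

/-- The `q`-analog of Kostant's partition function for the Lie algebra `g₂`: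
`℘_q(m,n) = Σ q^(a+b+c+d+e+f)` over all `(a,b,c,d,e,f) ∈ ℕ⁶` with
`a + c + 2d + 3e + 3f = m` and `b + c + d + e + 2f = n`. -/
noncomputable def g2P (m n : ℕ) : Polynomial ℤ :=
  ∑ t ∈ (Finset.range (m + 1) ×ˢ Finset.range (n + 1) ×ˢ Finset.range (m + 1) ×ˢ
        Finset.range (m + 1) ×ˢ Finset.range (m + 1) ×ˢ Finset.range (m + 1)).filter
      (fun t : ℕ × ℕ × ℕ × ℕ × ℕ × ℕ =>
        t.1 + t.2.2.1 + 2 * t.2.2.2.1 + 3 * t.2.2.2.2.1 + 3 * t.2.2.2.2.2 = m ∧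
        t.2.1 + t.2.2.1 + t.2.2.2.1 + t.2.2.2.2.1 + 2 * t.2.2.2.2.2 = n),
    Polynomial.X ^ (t.1 + t.2.1 + t.2.2.1 + t.2.2.2.1 + t.2.2.2.2.1 + t.2.2.2.2.2)

theorem g2P_eq_nested_sum (m n : ℕ) :
    g2P m n =
      ∑ i ∈ Finset.range (min (m / 3) (n / 2) + 1),
        ∑ j ∈ Finset.range (min ((m - 3 * i) / 3) (n - 2 * i) + 1),
          ∑ k ∈ Finset.range (min ((m - 3 * i - 3 * j) / 2) (n - 2 * i - j) + 1),
            ∑ l ∈ Finset.range (min (m - 3 * i - 3 * j - 2 * k) (n - 2 * i - j - k) + 1),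
              (Polynomial.X : Polynomial ℤ) ^ (m + n - 4 * i - 3 * j - 2 * k - l) := by
  unfold g2P
  simp only [Finset.sum_sigma']
  refine Finset.sum_bij'
    (fun t _ => ⟨t.2.2.2.2.2, t.2.2.2.2.1, t.2.2.2.1, t.2.2.1⟩)
    (fun s _ => (m - 3 * s.1 - 3 * s.2.1 - 2 * s.2.2.1 - s.2.2.2,
      n - 2 * s.1 - s.2.1 - s.2.2.1 - s.2.2.2, s.2.2.2, s.2.2.1, s.2.1, s.1)) ?_ ?_ ?_ ?_ ?_
  · rintro ⟨a, b, c, d, e, f⟩ h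
    simp only [Finset.mem_filter, Finset.mem_product, Finset.mem_range, Finset.mem_sigma] at h ⊢
    omega
  · rintro ⟨i, j, k, l⟩ h
    simp only [Finset.mem_filter, Finset.mem_product, Finset.mem_range, Finset.mem_sigma] at h ⊢
    omega
  · rintro ⟨a, b, c, d, e, f⟩ h
    simp only [Finset.mem_filter, Finset.mem_product, Finset.mem_range] at h
    simp only [Prod.mk.injEq, and_true]
    omega
  · rintro ⟨i, j, k, l⟩ h
    rfl
  · rintro ⟨a, b, c, d, e, f⟩ h
    simp only [Finset.mem_filter, Finset.mem_product, Finset.mem_range] at h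
    congr 1
    simp only
    omega
end

section
/- (Corrected Corollary 3.3 of Harris–Lauber, case n ≥ m) For all m, n ∈ ℕ with n ≥ m, the sp₄(ℂ) partition value satisfies ℘(m,n) = (⌊m/2⌋ + 1)(m − ⌊m/2⌋ + 1). -/
open Finset

/-- Kostant's partition function for the Lie algebra `sp₄(ℂ)`:
`℘(m,n)` is the number of tuples `(a,b,c,d) ∈ ℕ⁴` with `a + c + 2d = m` and
`b + c + d = n`, i.e. the number of ways to write `mα₁ + nα₂` as a nonnegative
integer combination of the positive roots `α₁, α₂, α₁+α₂, 2α₁+α₂`. -/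
def sp4P (m n : ℕ) : ℕ :=
  ((Finset.range (m + 1) ×ˢ Finset.range (n + 1) ×ˢ Finset.range (n + 1) ×ˢ
      Finset.range (n + 1)).filter
    (fun t : ℕ × ℕ × ℕ × ℕ =>
      t.1 + t.2.2.1 + 2 * t.2.2.2 = m ∧ t.2.1 + t.2.2.1 + t.2.2.2 = n)).card

theorem sp4P_aux (m k : ℕ) (hk : 2 * k ≤ m) :
    ∑ d ∈ Finset.range (k + 1), (m - 2 * d + 1) = (k + 1) * (m - k + 1) := by
  induction k with
  | zero => simp
  | succ k ih =>
    rw [Finset.sum_range_succ, ih (by omega)]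
    obtain ⟨r, rfl⟩ := Nat.exists_eq_add_of_le hk
    have h1 : 2 * (k + 1) + r - k = k + 2 + r := by omega
    have h2 : 2 * (k + 1) + r - 2 * (k + 1) = r := by omega
    have h3 : 2 * (k + 1) + r - (k + 1) = k + 1 + r := by omega
    rw [h1, h2, h3]
    ring

theorem sp4P_of_le (m n : ℕ) (h : n ≥ m) :
    sp4P m n = (m / 2 + 1) * (m - m / 2 + 1) := by
  rw [← sp4P_aux m (m / 2) (by omega)]
  have hs : ∑ d ∈ Finset.range (m / 2 + 1), (m - 2 * d + 1) =
      ((Finset.range (m / 2 + 1)).sigma (fun d => Finset.range (m - 2 * d + 1))).card := by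
    simp [Finset.card_sigma]
  rw [hs]
  unfold sp4P
  refine Finset.card_bij' (fun t _ => (⟨t.2.2.2, t.2.2.1⟩ : (_ : ℕ) × ℕ))
    (fun p _ => (m - p.2 - 2 * p.1, n - p.2 - p.1, p.2, p.1)) ?_ ?_ ?_ ?_
  · rintro ⟨a, b, c, d⟩ ht
    simp only [Finset.mem_filter, Finset.mem_product, Finset.mem_range, Finset.mem_sigma] at ht ⊢
    omega
  · rintro ⟨d, c⟩ hp
    simp only [Finset.mem_filter, Finset.mem_product, Finset.mem_range, Finset.mem_sigma] at hp ⊢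
    omega
  · rintro ⟨a, b, c, d⟩ ht
    simp only [Finset.mem_filter, Finset.mem_product, Finset.mem_range, Prod.mk.injEq, and_true] at ht ⊢
    omega
  · rintro ⟨d, c⟩ hp
    rfl
end

section
/- (Corrected Corollary 3.3 of Harris–Lauber, case 2n−1 > m > n) For all m, n ∈ ℕ with 2n − 1 > m and m > n, the sp₄(ℂ) partition value satisfies, as an identity of integers, 2·℘(m,n) = 2mn − m² − n² + m + n + 2·⌊m/2⌋·(m − ⌊m/2⌋) + 2. -/
open Finset

theorem sp4P_eq_sum (m n : ℕ) (h : m / 2 ≤ n) :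
    sp4P m n = ∑ d ∈ Finset.range (m / 2 + 1), (min (m - 2 * d) (n - d) + 1) := by
  have h2 : ∑ d ∈ Finset.range (m / 2 + 1), (min (m - 2 * d) (n - d) + 1)
      = ((Finset.range (m / 2 + 1)).sigma
        (fun d => Finset.range (min (m - 2 * d) (n - d) + 1))).card := by
    simp [Finset.card_sigma]
  rw [h2]
  unfold sp4P
  refine Finset.card_bij' (fun t _ => (⟨t.2.2.2, t.2.2.1⟩ : Σ _ : ℕ, ℕ))
    (fun s _ => (m - 2 * s.1 - s.2, n - s.1 - s.2, s.2, s.1)) ?_ ?_ ?_ ?_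
  · rintro ⟨a, b, c, d⟩ ht
    simp only [Finset.mem_filter, Finset.mem_product, Finset.mem_range, Finset.mem_sigma] at ht ⊢
    omega
  · rintro ⟨d, c⟩ ht
    simp only [Finset.mem_filter, Finset.mem_product, Finset.mem_range, Finset.mem_sigma] at ht ⊢
    omega
  · rintro ⟨a, b, c, d⟩ ht
    simp only [Finset.mem_filter, Finset.mem_product, Finset.mem_range, Prod.mk.injEq] at ht ⊢
    exact ⟨by omega, by omega, by trivial⟩
  · rintro ⟨d, c⟩ ht
    rfl

theorem sp4_sum_low (m n k : ℕ) (hk : m = n + k) (hkn : k ≤ n) (t : ℕ) (ht : t ≤ k) :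
    2 * ((∑ d ∈ Finset.range t, (min (m - 2 * d) (n - d) + 1) : ℕ) : ℤ)
      = 2 * t * (n + 1) - t * (t - 1) := by
  induction t with
  | zero => simp
  | succ t ih =>
    rw [Finset.sum_range_succ]
    have e : ((min (m - 2 * t) (n - t) + 1 : ℕ) : ℤ) = n - t + 1 := by omega
    rw [Nat.cast_add, e, mul_add, ih (by omega)]
    push_cast
    ring

theorem sp4_sum_high (m n k : ℕ) (hk : m = n + k) (hkn : k ≤ n) (r : ℕ)
    (hr : k + r ≤ m / 2 + 1) :
    2 * ((∑ d ∈ Finset.range (k + r), (min (m - 2 * d) (n - d) + 1) : ℕ) : ℤ)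
      = 2 * k * (n + 1) - k * (k - 1) + 2 * r * (m - 2 * k + 1) - 2 * r * (r - 1) := by
  induction r with
  | zero => simpa using sp4_sum_low m n k hk hkn k le_rfl
  | succ r ih =>
    rw [← add_assoc, Finset.sum_range_succ]
    have e : ((min (m - 2 * (k + r)) (n - (k + r)) + 1 : ℕ) : ℤ) = m - 2 * (k + r) + 1 := by
      omega
    rw [Nat.cast_add, e, mul_add, ih (by omega)]
    push_cast
    ring

theorem sp4P_middle_case (m n : ℕ) (h1 : (2 * n - 1 : ℤ) > m) (h2 : m > n) :
    2 * (sp4P m n : ℤ) =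
      2 * m * n - m ^ 2 - n ^ 2 + m + n
        + 2 * ((m / 2 : ℕ) : ℤ) * ((m : ℤ) - ((m / 2 : ℕ) : ℤ)) + 2 := by
  rw [sp4P_eq_sum m n (by omega)]
  obtain ⟨k, hk⟩ := Nat.exists_eq_add_of_lt h2
  obtain ⟨r, hr⟩ : ∃ r, m / 2 + 1 = (k + 1) + r := ⟨m / 2 - k, by omega⟩
  have h := sp4_sum_high m n (k + 1) (by omega) (by omega) r (by omega)
  rw [hr, h]
  have hq : ((m / 2 : ℕ) : ℤ) = k + r := by omega
  have hm : (m : ℤ) = n + k + 1 := by omega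
  rw [hq, hm]
  push_cast
  ring
end

section
/- (Corrected Corollary 3.3 of Harris–Lauber, the previously missing case 2n > m ≥ 2n−1 > n) For all m, n ∈ ℕ with 2n > m, m ≥ 2n − 1 and 2n − 1 > n, the sp₄(ℂ) partition value satisfies, as an identity of integers, 2·℘(m,n) = (⌊m/2⌋ + 1)(2n − ⌊m/2⌋ + 2). -/
open Finset

lemma sp4P_eq_sum_s18 (k : ℕ) : sp4P (2 * k + 1) (k + 1) = ∑ e ∈ Finset.range (k + 1), (e + 2) := by
  have h : ∑ e ∈ Finset.range (k + 1), (e + 2)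
      = ((Finset.range (k + 1)).sigma (fun e => Finset.range (e + 2))).card := by
    simp
  rw [h, sp4P]
  refine Finset.card_bij' (fun t _ => ⟨k - t.2.2.2, t.2.2.1⟩)
    (fun s _ => (2 * k + 1 - s.2 - 2 * (k - s.1), k + 1 - s.2 - (k - s.1), s.2, k - s.1))
    ?_ ?_ ?_ ?_
  · rintro ⟨a, b, c, d⟩ ht
    simp only [Finset.mem_filter, Finset.mem_product, Finset.mem_range, Finset.mem_sigma] at ht ⊢
    omega
  · rintro ⟨e, c⟩ hs
    simp only [Finset.mem_filter, Finset.mem_product, Finset.mem_range, Finset.mem_sigma] at hs ⊢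
    omega
  · rintro ⟨a, b, c, d⟩ ht
    simp only [Finset.mem_filter, Finset.mem_product, Finset.mem_range] at ht
    ext <;> dsimp only <;> omega
  · rintro ⟨e, c⟩ hs
    simp only [Finset.mem_range, Finset.mem_sigma] at hs
    have : k - (k - e) = e := by omega
    simp [this]

lemma two_mul_sum_aux (k : ℕ) :
    2 * ∑ e ∈ Finset.range (k + 1), (e + 2) = (k + 1) * (k + 4) := by
  induction k with
  | zero => simp
  | succ k ih => rw [Finset.sum_range_succ, mul_add, ih]; ring

theorem sp4P_missing_case (m n : ℕ) (h1 : (2 * n : ℤ) > m)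
    (h2 : (m : ℤ) ≥ 2 * n - 1) (h3 : (2 * n - 1 : ℤ) > n) :
    2 * (sp4P m n : ℤ) =
      (((m / 2 : ℕ) : ℤ) + 1) * (2 * n - ((m / 2 : ℕ) : ℤ) + 2) := by
  obtain ⟨k, rfl⟩ : ∃ k, n = k + 1 := ⟨n - 1, by omega⟩
  obtain rfl : m = 2 * k + 1 := by omega
  have hk : (2 * k + 1) / 2 = k := by omega
  have h := two_mul_sum_aux k
  rw [← sp4P_eq_sum_s18] at h
  rw [hk]
  have h' : 2 * (sp4P (2 * k + 1) (k + 1) : ℤ) = (k + 1) * (k + 4) := by exact_mod_cast h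
  rw [h']
  push_cast
  ring
end

section
/- (Corrected Corollary 3.3 of Harris–Lauber, case m ≥ 2n) For all m, n ∈ ℕ with m ≥ 2n, the sp₄(ℂ) partition value satisfies 2·℘(m,n) = (n + 1)(n + 2). -/
open Finset

theorem sp4P_of_two_mul_le (m n : ℕ) (h : m ≥ 2 * n) :
    2 * sp4P m n = (n + 1) * (n + 2) := by
  have key : sp4P m n = ((Finset.range (n + 1)).sigma (fun s => Finset.range (s + 1))).card := by
    unfold sp4P
    refine Finset.card_bij' (fun t _ => (⟨t.2.2.1 + t.2.2.2, t.2.2.2⟩ : Σ _ : ℕ, ℕ))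
      (fun p _ => (m - (p.1 - p.2) - 2 * p.2, n - p.1, p.1 - p.2, p.2)) ?_ ?_ ?_ ?_
    · rintro ⟨a, b, c, d⟩ ht
      simp only [Finset.mem_filter, Finset.mem_product, Finset.mem_range, Finset.mem_sigma] at *
      omega
    · rintro ⟨s, d⟩ ht
      simp only [Finset.mem_filter, Finset.mem_product, Finset.mem_range, Finset.mem_sigma] at *
      omega
    · rintro ⟨a, b, c, d⟩ ht
      simp only [Finset.mem_filter, Finset.mem_product, Finset.mem_range] at ht
      simp only [Prod.mk.injEq]
      refine ⟨?_, ?_, ?_, trivial⟩ <;> omega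
    · rintro ⟨s, d⟩ ht
      simp only [Finset.mem_range, Finset.mem_sigma] at ht
      have e : s - d + d = s := by omega
      simp only [e]
  rw [key, Finset.card_sigma]
  simp only [Finset.card_range]
  clear key h
  induction n with
  | zero => simp
  | succ k ih =>
    rw [Finset.sum_range_succ, mul_add, ih]
    ring
end
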